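/- Let (R, m) be a local Noetherian ring, I an integrally closed m-primary ideal, and M a finitely generated R-module. Then for t ≥ 1, M has projective dimension less than t if and only if Tor_t^R(R/I, M) = 0. -/

import Mathlib

universe u

/-- `x` is integral over the ideal `I`: it satisfies an equation
`x^m + b_1 x^{m-1} + ... + b_m = 0` with `b_j ∈ I^j` and `m ≥ 1`. -/
def Ideal.IsIntegralElem' {R : Type*} [CommRing R] (I : Ideal R) (x : R) : Prop :=
  ∃ m : ℕ, 0 < m ∧ ∃ b : ℕ → R, (∀ j, 1 ≤ j → j ≤ m → b j ∈ I ^ j) ∧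
    x ^ m + ∑ j ∈ Finset.Icc 1 m, b j * x ^ (m - j) = 0

/-- The integral closure of an ideal, as an ideal.  (Since the set of elements integral
over `I` is an ideal, taking the span adds nothing.) -/
def Ideal.intClosure {R : Type*} [CommRing R] (I : Ideal R) : Ideal R :=
  Ideal.span {x | I.IsIntegralElem' x}

/-- An ideal is integrally closed if it contains every element integral over it. -/
def Ideal.IsIntClosed {R : Type*} [CommRing R] (I : Ideal R) : Prop :=
  ∀ x, I.IsIntegralElem' x → x ∈ I

/-- The minimal number of generators of an ideal. -/
noncomputable def Ideal.mu {R : Type*} [CommRing R] (I : Ideal R) : ℕ :=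
  sInf {n | ∃ f : Fin n → R, Ideal.span (Set.range f) = I}
open CategoryTheory in
/-- `Ext^n_R(M, N)`, via the derived functor `Ext` on `ModuleCat R`. -/
noncomputable def ExtMod (R : Type u) [CommRing R] (M N : Type u)
    [AddCommGroup M] [Module R M] [AddCommGroup N] [Module R N] (n : ℕ) : Type u :=
  ((Ext R (ModuleCat.{u} R) n).obj (Opposite.op (ModuleCat.of R M))).obj (ModuleCat.of R N)

open CategoryTheory in
noncomputable instance (R : Type u) [CommRing R] (M N : Type u)
    [AddCommGroup M] [Module R M] [AddCommGroup N] [Module R N] (n : ℕ) :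
    AddCommGroup (ExtMod R M N n) :=
  inferInstanceAs (AddCommGroup
    (((Ext R (ModuleCat.{u} R) n).obj (Opposite.op (ModuleCat.of R M))).obj (ModuleCat.of R N)))

open CategoryTheory in
noncomputable instance (R : Type u) [CommRing R] (M N : Type u)
    [AddCommGroup M] [Module R M] [AddCommGroup N] [Module R N] (n : ℕ) :
    Module R (ExtMod R M N n) :=
  inferInstanceAs (Module R
    (((Ext R (ModuleCat.{u} R) n).obj (Opposite.op (ModuleCat.of R M))).obj (ModuleCat.of R N)))

/-- `M` has projective dimension at most `n`: `Ext^{n+1}(M, -)` vanishes. -/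
noncomputable def HasProjDimLE (R : Type u) [CommRing R] (M : Type u)
    [AddCommGroup M] [Module R M] (n : ℕ) : Prop :=
  ∀ (N : Type u) [AddCommGroup N] [Module R N], Subsingleton (ExtMod R M N (n + 1))

/-- `M` has projective dimension exactly `n` (in particular, finite). -/
noncomputable def ProjDimEq (R : Type u) [CommRing R] (M : Type u)
    [AddCommGroup M] [Module R M] (n : ℕ) : Prop :=
  HasProjDimLE R M n ∧ ∀ m, HasProjDimLE R M m → n ≤ m

/-- `M` has projective dimension `< n` (with the convention `pd 0 = -∞`). -/
noncomputable def ProjDimLT (R : Type u) [CommRing R] (M : Type u)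
    [AddCommGroup M] [Module R M] (n : ℕ) : Prop :=
  Subsingleton M ∨ ∃ k, n = k + 1 ∧ HasProjDimLE R M k
open CategoryTheory in
/-- `Tor^R_n(M, N)`, via the derived functor `Tor` on `ModuleCat R`. -/
noncomputable def TorMod (R : Type u) [CommRing R] (M N : Type u)
    [AddCommGroup M] [Module R M] [AddCommGroup N] [Module R N] (n : ℕ) : Type u :=
  ((Tor (ModuleCat.{u} R) n).obj (ModuleCat.of R M)).obj (ModuleCat.of R N)

open CategoryTheory in
noncomputable instance (R : Type u) [CommRing R] (M N : Type u)
    [AddCommGroup M] [Module R M] [AddCommGroup N] [Module R N] (n : ℕ) :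
    AddCommGroup (TorMod R M N n) :=
  inferInstanceAs (AddCommGroup
    (((Tor (ModuleCat.{u} R) n).obj (ModuleCat.of R M)).obj (ModuleCat.of R N)))

open CategoryTheory in
noncomputable instance (R : Type u) [CommRing R] (M N : Type u)
    [AddCommGroup M] [Module R M] [AddCommGroup N] [Module R N] (n : ℕ) :
    Module R (TorMod R M N n) :=
  inferInstanceAs (Module R
    (((Tor (ModuleCat.{u} R) n).obj (ModuleCat.of R M)).obj (ModuleCat.of R N)))

section DeterminantTrick

open IsLocalRing TensorProduct Polynomial

/-- A root of a monic polynomial whose coefficients lie in the appropriate powers of `I` is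
integral over `I`. -/
lemma Ideal.IsIntegralElem'.of_monic {R : Type*} [CommRing R] {I : Ideal R} {x : R} {p : R[X]}
    (hp : p.Monic) (hdeg : 0 < p.natDegree) (hcoeff : ∀ k, p.coeff k ∈ I ^ (p.natDegree - k))
    (hx : p.eval x = 0) : I.IsIntegralElem' x := by
  refine ⟨p.natDegree, hdeg, fun j => p.coeff (p.natDegree - j), fun j _ hj => ?_, ?_⟩
  · simpa [Nat.sub_sub_self hj] using hcoeff (p.natDegree - j)
  · rw [eval_eq_sum_range, Finset.sum_range_succ, hp.coeff_natDegree, one_mul, add_comm] at hx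
    rw [← hx]
    congr 1
    refine Finset.sum_nbij' (fun j => p.natDegree - j) (fun j => p.natDegree - j) ?_ ?_ ?_ ?_ ?_
    all_goals intro j hj
    all_goals simp only [Finset.mem_Icc, Finset.mem_range] at hj ⊢
    all_goals omega

/-- The ideal generated by the coordinates of the elements of a submodule of a free module. -/
def Submodule.coordIdeal {R ι : Type*} [CommRing R] (K : Submodule R (ι → R)) : Ideal R :=
  ⨆ i, K.map (LinearMap.proj i)

namespace Submodule

variable {R ι : Type*} [CommRing R]

lemma coordIdeal_le_iff {K : Submodule R (ι → R)} {J : Ideal R} :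
    K.coordIdeal ≤ J ↔ ∀ x ∈ K, ∀ i, x i ∈ J := by
  simp only [coordIdeal, iSup_le_iff, Submodule.map_le_iff_le_comap]
  exact ⟨fun h x hx i => h i hx, fun h i x hx => h x hx i⟩

lemma apply_mem_coordIdeal {K : Submodule R (ι → R)} {x : ι → R} (hx : x ∈ K) (i : ι) :
    x i ∈ K.coordIdeal :=
  coordIdeal_le_iff.1 le_rfl x hx i

/-- If `a` multiplies the coordinates of `K` into `I`, then the determinant trick produces an
integral equation that annihilates `K`, hence also its coordinates, hence also `a`. -/
lemma mem_of_mem_coordIdeal_of_mul_mem {I : Ideal R} (hI : I.IsIntClosed)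
    {K : Submodule R (ι → R)} [Module.Finite R K]
    (hK : ∀ x ∈ K, (∀ i, x i ∈ I) → x ∈ I • K)
    {a : R} (ha : a ∈ K.coordIdeal) (hmul : ∀ b ∈ K.coordIdeal, a * b ∈ I) : a ∈ I := by
  have hrange : LinearMap.range (algebraMap R (Module.End R K) a) ≤ I • ⊤ := by
    rintro _ ⟨x, rfl⟩
    have h : a • (x : ι → R) ∈ I • K :=
      hK _ (K.smul_mem a x.2) fun i => hmul _ (apply_mem_coordIdeal x.2 i)
    have hmap : (I • (⊤ : Submodule R K)).map K.subtype = I • K := by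
      rw [Submodule.map_smul'', Submodule.map_top, Submodule.range_subtype]
    rw [← hmap] at h
    obtain ⟨y, hy, hyx⟩ := h
    have hxy : algebraMap R (Module.End R K) a x = y := Subtype.ext hyx.symm
    rwa [hxy]
  obtain ⟨p, hp, -, hcoeff, hzero⟩ :=
    LinearMap.exists_monic_and_natDegree_eq_and_coeff_mem_pow_and_aeval_eq_zero R _ I hrange
  have hkill : ∀ b ∈ K.coordIdeal, p.eval a * b = 0 := by
    have : K.coordIdeal ≤ LinearMap.ker (LinearMap.mulLeft R (p.eval a)) := by
      refine coordIdeal_le_iff.2 fun x hx i => ?_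
      have h := LinearMap.congr_fun hzero ⟨x, hx⟩
      rw [aeval_algebraMap_apply] at h
      simpa using congr_fun (congr_arg Subtype.val h) i
    exact fun b hb => this hb
  nontriviality R
  refine hI a (.of_monic (p := X * p) (monic_X.mul hp) ?_ (fun k => ?_) ?_)
  · rw [natDegree_X_mul hp.ne_zero]
    omega
  · rw [natDegree_X_mul hp.ne_zero]
    cases k with
    | zero => simp
    | succ k => simpa using hcoeff k
  · rw [eval_mul, eval_X, mul_comm, hkill a ha]

lemma eq_bot_of_isIntClosed [IsLocalRing R] [IsNoetherianRing R] {I : Ideal R}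
    (hI : I.IsIntClosed) (hrad : I.radical = maximalIdeal R) {K : Submodule R (ι → R)}
    [Module.Finite R K] (hmin : ∀ x ∈ K, ∀ i, x i ∈ maximalIdeal R)
    (hK : ∀ x ∈ K, (∀ i, x i ∈ I) → x ∈ I • K) : K = ⊥ := by
  have hpow : ∀ n : ℕ, K.coordIdeal ^ (n + 1) ≤ I → K.coordIdeal ≤ I := by
    intro n
    induction n with
    | zero => simp
    | succ n ih =>
      refine fun h => ih fun a ha => ?_
      refine mem_of_mem_coordIdeal_of_mul_mem hI hK (Ideal.pow_le_self n.succ_ne_zero ha) ?_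
      exact fun b hb => h (by rw [pow_succ]; exact Ideal.mul_mem_mul ha hb)
  obtain ⟨n, hn⟩ := I.exists_radical_pow_le_of_fg (IsNoetherian.noetherian _)
  have hle : K.coordIdeal ≤ I := hpow n <| calc
    K.coordIdeal ^ (n + 1) ≤ I.radical ^ (n + 1) :=
      Ideal.pow_right_mono (hrad ▸ coordIdeal_le_iff.2 hmin) _
    _ ≤ I.radical ^ n := Ideal.pow_le_pow_right n.le_succ
    _ ≤ I := hn
  refine Submodule.eq_bot_of_le_smul_of_le_jacobson_bot I K (Module.Finite.iff_fg.1 ‹_›)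
    (fun x hx => hK x hx (coordIdeal_le_iff.1 hle x hx)) ?_
  rw [IsLocalRing.jacobson_eq_maximalIdeal ⊥ bot_ne_top, ← hrad]
  exact Ideal.le_radical

lemma mem_smul_of_lTensor_injective [Finite ι] {I : Ideal R} {K : Submodule R (ι → R)}
    (h : Function.Injective (K.subtype.lTensor (R ⧸ I))) {x : ι → R} (hx : x ∈ K)
    (hxI : ∀ i, x i ∈ I) : x ∈ I • K := by
  classical
  have := Fintype.ofFinite ι
  have hzero : (1 : R ⧸ I) ⊗ₜ[R] (⟨x, hx⟩ : K) = 0 := by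
    apply h
    have hsum : K.subtype ⟨x, hx⟩ = ∑ i, x i • Pi.single i 1 := pi_eq_sum_univ' x
    rw [map_zero, LinearMap.lTensor_tmul, hsum, TensorProduct.tmul_sum]
    refine Finset.sum_eq_zero fun i _ => ?_
    have : x i • (1 : R ⧸ I) = 0 := by
      rw [Algebra.smul_def, mul_one]
      exact Ideal.Quotient.eq_zero_iff_mem.2 (hxI i)
    rw [TensorProduct.tmul_smul, TensorProduct.smul_tmul', this, TensorProduct.zero_tmul]
  have hq := congr_arg (TensorProduct.quotTensorEquivQuotSMul K I) hzero
  rw [map_zero, ← map_one (Ideal.Quotient.mk I),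
    TensorProduct.quotTensorEquivQuotSMul_mk_tmul, one_smul, Submodule.Quotient.mk_eq_zero] at hq
  have hmap := Submodule.mem_map_of_mem (f := K.subtype) hq
  rwa [Submodule.map_smul'', Submodule.map_top, Submodule.range_subtype] at hmap

end Submodule

/-- A finite module over a local ring is a quotient of a finite free module by a submodule of
vectors with entries in the maximal ideal. -/
lemma IsLocalRing.exists_minimal_presentation (R M : Type*) [CommRing R] [IsLocalRing R]
    [AddCommGroup M] [Module R M] [Module.Finite R M] :
    ∃ (n : ℕ) (f : (Fin n → R) →ₗ[R] M), Function.Surjective f ∧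
      ∀ x ∈ LinearMap.ker f, ∀ i, x i ∈ maximalIdeal R := by
  let b := Module.finBasis (ResidueField R) (ResidueField R ⊗[R] M)
  obtain ⟨v, hv⟩ := (TensorProduct.mk_surjective R M (ResidueField R)
    Ideal.Quotient.mk_surjective).comp_left b
  refine ⟨_, Fintype.linearCombination R v, ?_, fun x hx i => ?_⟩
  · rw [← LinearMap.range_eq_top, Fintype.range_linearCombination]
    exact span_eq_top_of_tmul_eq_basis v b (congr_fun hv)
  · have h := congr_arg (TensorProduct.mk R (ResidueField R) M 1) hx
    rw [Fintype.linearCombination_apply, map_sum, map_zero] at h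
    simp only [map_smul] at h
    have h' : ∑ j, residue R (x j) • b j = 0 := by
      rw [← h]
      refine Finset.sum_congr rfl fun j _ => ?_
      rw [← congr_fun hv j]
      exact algebraMap_smul (ResidueField R) (x j) _
    exact (residue_eq_zero_iff _).1
      (Fintype.linearIndependent_iff.1 b.linearIndependent _ h' i)

end DeterminantTrick

namespace CategoryTheory

open Limits

variable {C : Type*} [Category* C] [Abelian C]

namespace ProjectiveResolution

/-- The augmentation of a projective resolution, as a morphism to the resolved object. -/
noncomputable def augmentation {X : C} (Q : ProjectiveResolution X) : Q.complex.X 0 ⟶ X :=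
  Q.π.f 0

@[simp]
lemma d_comp_augmentation {X : C} (Q : ProjectiveResolution X) :
    Q.complex.d 1 0 ≫ Q.augmentation = 0 :=
  Q.complex_d_comp_π_f_zero

@[simp]
lemma d_comp_augmentation_assoc {X Y : C} (Q : ProjectiveResolution X) (f : X ⟶ Y) :
    Q.complex.d 1 0 ≫ Q.augmentation ≫ f = 0 := by
  rw [← Category.assoc, d_comp_augmentation, zero_comp]

instance {X : C} (Q : ProjectiveResolution X) : Epi Q.augmentation :=
  inferInstanceAs (Epi (Q.π.f 0))

lemma exact_augmentation {X : C} (Q : ProjectiveResolution X) :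
    (ShortComplex.mk _ _ Q.d_comp_augmentation).Exact :=
  ShortComplex.exact_of_g_is_cokernel _ Q.isColimitCokernelCofork

variable {S : ShortComplex C} (Q : ProjectiveResolution S.X₁)

/-- The complex obtained by splicing a resolution of `S.X₁` with `S.f`. -/
noncomputable def spliceComplex : ChainComplex C ℕ :=
  Q.complex.augment (Q.augmentation ≫ S.f) (by simp)

lemma exact_splice_zero (hS : S.ShortExact) :
    (ShortComplex.mk (Q.augmentation ≫ S.f) S.g (by simp)).Exact := by
  let α : ShortComplex.mk (Q.augmentation ≫ S.f) S.g (by simp) ⟶ S :=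
    { τ₁ := Q.augmentation
      τ₂ := 𝟙 _
      τ₃ := 𝟙 _ }
  exact (ShortComplex.exact_iff_of_epi_of_isIso_of_mono α).2 hS.exact

lemma exact_splice_one (hS : S.ShortExact) :
    (ShortComplex.mk (Q.complex.d 1 0) (Q.augmentation ≫ S.f) (by simp)).Exact := by
  have := hS.mono_f
  let α : ShortComplex.mk _ _ Q.d_comp_augmentation ⟶
      ShortComplex.mk (Q.complex.d 1 0) (Q.augmentation ≫ S.f) (by simp) :=
    { τ₁ := 𝟙 _
      τ₂ := 𝟙 _
      τ₃ := S.f }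
  exact (ShortComplex.exact_iff_of_epi_of_isIso_of_mono α).1 Q.exact_augmentation

lemma spliceComplex_exactAt_succ (hS : S.ShortExact) (n : ℕ) :
    Q.spliceComplex.ExactAt (n + 1) := by
  rw [HomologicalComplex.exactAt_iff' _ (n + 1 + 1) (n + 1) n (by simp) (by simp)]
  cases n with
  | zero => exact Q.exact_splice_one hS
  | succ n => exact Q.exact_succ n

/-- Splicing a projective resolution of `X₁` onto a short exact sequence
`0 ⟶ X₁ ⟶ X₂ ⟶ X₃ ⟶ 0` with `X₂` projective gives a projective resolution of `X₃`. -/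
noncomputable def splice (hS : S.ShortExact) [Projective S.X₂] : ProjectiveResolution S.X₃ where
  complex := Q.spliceComplex
  projective n := by
    cases n with
    | zero => exact inferInstanceAs (Projective S.X₂)
    | succ n => exact Q.projective n
  π := (ChainComplex.toSingle₀Equiv _ _).symm ⟨S.g, by
    change (Q.augmentation ≫ S.f) ≫ S.g = 0
    simp⟩
  quasiIso := ⟨fun n => by
    cases n
    · rw [ChainComplex.quasiIsoAt₀_iff, ShortComplex.quasiIso_iff_of_zeros']
      · have := hS.epi_g
        refine (ShortComplex.exact_and_epi_g_iff_of_iso ?_).2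
          ⟨Q.exact_splice_zero hS, inferInstanceAs (Epi S.g)⟩
        refine ShortComplex.isoMk (Iso.refl _) (Iso.refl _) (Iso.refl _) ?_ ?_
        · exact (Category.id_comp _).trans (Category.comp_id _).symm
        · refine (Category.id_comp _).trans (.trans ?_ (Category.comp_id _).symm)
          exact (ChainComplex.toSingle₀Equiv_symm_apply_f_zero (C := Q.spliceComplex) S.g _).symm
      all_goals rfl
    · rw [quasiIsoAt_iff_exactAt']
      · exact Q.spliceComplex_exactAt_succ hS _
      · apply ChainComplex.exactAt_succ_single_obj⟩

end ProjectiveResolution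

variable {D : Type*} [Category* D] [Abelian D]

namespace Functor

variable (F : C ⥤ D) [F.Additive] [HasProjectiveResolutions C]

lemma isZero_leftDerived_succ_iff_exact {X : C} (P : ProjectiveResolution X) (n : ℕ) :
    IsZero ((F.leftDerived (n + 1)).obj X) ↔
      ((ShortComplex.mk _ _ (P.complex.d_comp_d (n + 2) (n + 1) n)).map F).Exact := by
  rw [(P.isoLeftDerivedObj F (n + 1)).isZero_iff, HomologicalComplex.homologyFunctor_obj,
    ← HomologicalComplex.exactAt_iff_isZero_homology,
    HomologicalComplex.exactAt_iff' _ (n + 2) (n + 1) n (by simp) (by simp)]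
  rfl

/-- Dimension shifting for left derived functors. -/
lemma isZero_leftDerived_succ_succ_iff {S : ShortComplex C} (hS : S.ShortExact)
    [Projective S.X₂] (n : ℕ) :
    IsZero ((F.leftDerived (n + 2)).obj S.X₃) ↔ IsZero ((F.leftDerived (n + 1)).obj S.X₁) := by
  let Q := projectiveResolution S.X₁
  rw [F.isZero_leftDerived_succ_iff_exact Q, F.isZero_leftDerived_succ_iff_exact (Q.splice hS)]
  rfl

lemma isZero_leftDerived_one_iff {S : ShortComplex C} (hS : S.ShortExact) [Projective S.X₂]
    (Q : ProjectiveResolution S.X₁) :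
    IsZero ((F.leftDerived 1).obj S.X₃) ↔
      ((ShortComplex.mk (Q.complex.d 1 0) (Q.augmentation ≫ S.f) (by simp)).map F).Exact := by
  rw [F.isZero_leftDerived_succ_iff_exact (Q.splice hS)]
  rfl

lemma mono_map_of_isZero_leftDerived_one [F.PreservesEpimorphisms] {S : ShortComplex C}
    (hS : S.ShortExact) [Projective S.X₂] (h : IsZero ((F.leftDerived 1).obj S.X₃)) :
    Mono (F.map S.f) := by
  let Q := projectiveResolution S.X₁
  rw [F.isZero_leftDerived_one_iff hS Q] at h
  rw [Preadditive.mono_iff_cancel_zero]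
  intro A x hx
  obtain ⟨A₁, π₁, _, y, hy⟩ := surjective_up_to_refinements_of_epi (F.map Q.augmentation) x
  obtain ⟨A₂, π₂, _, z, hz⟩ := h.exact_up_to_refinements y (by
    change y ≫ F.map (Q.augmentation ≫ S.f) = 0
    rw [F.map_comp, ← Category.assoc, ← hy, Category.assoc, hx, comp_zero])
  change A₂ ⟶ F.obj (Q.complex.X 1) at z
  replace hz : π₂ ≫ y = z ≫ F.map (Q.complex.d 1 0) := hz
  rw [← cancel_epi π₁, ← cancel_epi π₂, hy, ← Category.assoc, hz, Category.assoc, ← F.map_comp,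
    Q.d_comp_augmentation, F.map_zero, comp_zero, comp_zero, comp_zero]

end Functor

end CategoryTheory

section

open CategoryTheory Limits

variable {R : Type u} [CommRing R]

lemma subsingleton_torMod_iff (N M : Type u) [AddCommGroup M] [Module R M] [AddCommGroup N]
    [Module R N] (n : ℕ) : Subsingleton (TorMod R N M n) ↔
      IsZero ((((MonoidalCategory.tensoringLeft (ModuleCat.{u} R)).obj
        (ModuleCat.of R N)).leftDerived n).obj (ModuleCat.of R M)) :=
  ModuleCat.isZero_iff_subsingleton.symm

lemma subsingleton_extMod_iff (M N : Type u) [AddCommGroup M] [Module R M] [AddCommGroup N]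
    [Module R N] (n : ℕ) : Subsingleton (ExtMod R M N n) ↔
      IsZero ((((linearYoneda R (ModuleCat.{u} R)).obj (ModuleCat.of R N)).rightOp.leftDerived
        n).obj (ModuleCat.of R M)) :=
  ModuleCat.isZero_iff_subsingleton.symm.trans ⟨fun h => h.op, fun h => h.unop⟩

/-- If `Ext¹(X₃, X₁) = 0`, then a short exact sequence `0 ⟶ X₁ ⟶ X₂ ⟶ X₃ ⟶ 0` with `X₂`
projective splits. -/
lemma CategoryTheory.ShortComplex.ShortExact.exists_retraction_of_isZero
    {S : ShortComplex (ModuleCat.{u} R)} (hS : S.ShortExact) [Projective S.X₂]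
    (h : IsZero ((((linearYoneda R (ModuleCat.{u} R)).obj S.X₁).rightOp.leftDerived 1).obj
      S.X₃)) : ∃ r : S.X₂ ⟶ S.X₁, S.f ≫ r = 𝟙 _ := by
  let Q := projectiveResolution S.X₁
  rw [Functor.isZero_leftDerived_one_iff _ hS Q] at h
  obtain ⟨r, hr⟩ := (ShortComplex.moduleCat_exact_iff _).1 h.unop Q.augmentation
    Q.d_comp_augmentation
  change S.X₂ ⟶ S.X₁ at r
  refine ⟨r, ?_⟩
  rw [← cancel_epi Q.augmentation, Category.comp_id, ← Category.assoc]
  exact hr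

variable {F M : Type u} [AddCommGroup F] [Module R F] [AddCommGroup M] [Module R M]

/-- The short complex `ker f ⟶ F ⟶ M` attached to a linear map `f`. -/
noncomputable abbrev LinearMap.kerShortComplex (f : F →ₗ[R] M) : ShortComplex (ModuleCat.{u} R) :=
  ShortComplex.mk (ModuleCat.ofHom (LinearMap.ker f).subtype) (ModuleCat.ofHom f)
    (by ext x; exact x.2)

lemma LinearMap.kerShortComplex_shortExact {f : F →ₗ[R] M} (hf : Function.Surjective f) :
    f.kerShortComplex.ShortExact where
  exact := by
    rw [ShortComplex.moduleCat_exact_iff]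
    exact fun x hx => ⟨⟨x, hx⟩, rfl⟩
  mono_f := (ModuleCat.mono_iff_injective _).2 (Submodule.injective_subtype _)
  epi_g := (ModuleCat.epi_iff_surjective _).2 hf

lemma Module.Projective.of_hasProjDimLE_zero (h : HasProjDimLE R M 0) : Module.Projective R M := by
  let f : (M →₀ R) →ₗ[R] M := Finsupp.linearCombination R id
  have hf : Function.Surjective f := Finsupp.linearCombination_id_surjective R M
  obtain ⟨r, hr⟩ := (f.kerShortComplex_shortExact hf).exists_retraction_of_isZero
    ((subsingleton_extMod_iff M (LinearMap.ker f) 1).1 (h (LinearMap.ker f)))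
  have hsplit := (f.exact_subtype_ker_map.split_tfae (Submodule.injective_subtype _) hf).out 0 1
  obtain ⟨s, hs⟩ := hsplit.2 ⟨r.hom, congr_arg ModuleCat.Hom.hom hr⟩
  exact .of_split s f hs

lemma Module.Projective.hasProjDimLE [Module.Projective R M] (n : ℕ) : HasProjDimLE R M n :=
  fun N _ _ => ModuleCat.subsingleton_of_isZero
    (isZero_Ext_succ_of_projective (ModuleCat.of R M) (ModuleCat.of R N) n)

lemma subsingleton_torMod_succ_of_projective (N : Type u) [AddCommGroup N] [Module R N]
    [Module.Projective R M] (n : ℕ) : Subsingleton (TorMod R N M (n + 1)) :=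
  ModuleCat.subsingleton_of_isZero
    (isZero_Tor_succ_of_projective _ (ModuleCat.of R N) (ModuleCat.of R M) n)

lemma hasProjDimLE_succ_iff [Module.Projective R F] {f : F →ₗ[R] M} (hf : Function.Surjective f)
    (n : ℕ) : HasProjDimLE R M (n + 1) ↔ HasProjDimLE R (LinearMap.ker f) n := by
  refine forall_congr' fun N => forall_congr' fun _ => forall_congr' fun _ => ?_
  rw [subsingleton_extMod_iff, subsingleton_extMod_iff]
  exact Functor.isZero_leftDerived_succ_succ_iff _ (LinearMap.kerShortComplex_shortExact hf) n

lemma subsingleton_torMod_succ_succ_iff [Module.Projective R F] {f : F →ₗ[R] M}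
    (hf : Function.Surjective f) (N : Type u) [AddCommGroup N] [Module R N] (n : ℕ) :
    Subsingleton (TorMod R N M (n + 2)) ↔
      Subsingleton (TorMod R N (LinearMap.ker f) (n + 1)) := by
  rw [subsingleton_torMod_iff, subsingleton_torMod_iff]
  exact Functor.isZero_leftDerived_succ_succ_iff _ (LinearMap.kerShortComplex_shortExact hf) n

lemma lTensor_injective_of_subsingleton_torMod_one [Module.Projective R F] {f : F →ₗ[R] M}
    (hf : Function.Surjective f) {N : Type u} [AddCommGroup N] [Module R N]
    (h : Subsingleton (TorMod R N M 1)) :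
    Function.Injective ((LinearMap.ker f).subtype.lTensor N) := by
  rw [subsingleton_torMod_iff] at h
  have := Functor.mono_map_of_isZero_leftDerived_one _
    (LinearMap.kerShortComplex_shortExact hf) h
  exact (ModuleCat.mono_iff_injective _).1 this

end

lemma projDimLT_succ_iff {R M : Type u} [CommRing R] [AddCommGroup M] [Module R M] (n : ℕ) :
    ProjDimLT R M (n + 1) ↔ HasProjDimLE R M n := by
  constructor
  · rintro (h | ⟨k, hk, h⟩)
    · exact Module.Projective.hasProjDimLE n
    · rwa [Nat.succ_injective hk]
  · exact fun h => .inr ⟨n, rfl, h⟩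

section

open IsLocalRing

variable {R : Type u} [CommRing R] [IsLocalRing R] [IsNoetherianRing R] {I : Ideal R}

lemma projective_of_subsingleton_torMod_one (hintcl : I.IsIntClosed)
    (hprimary : I.radical = maximalIdeal R) {M : Type u} [AddCommGroup M] [Module R M]
    [Module.Finite R M] (h : Subsingleton (TorMod R (R ⧸ I) M 1)) : Module.Projective R M := by
  obtain ⟨n, f, hf, hmin⟩ := exists_minimal_presentation R M
  have hker : LinearMap.ker f = ⊥ := Submodule.eq_bot_of_isIntClosed hintcl hprimary hmin
    fun x hx hxI => Submodule.mem_smul_of_lTensor_injective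
      (lTensor_injective_of_subsingleton_torMod_one hf h) hx hxI
  exact .of_equiv' (LinearEquiv.ofBijective f ⟨LinearMap.ker_eq_bot.1 hker, hf⟩)

lemma hasProjDimLE_iff_subsingleton_torMod (hintcl : I.IsIntClosed)
    (hprimary : I.radical = maximalIdeal R) {M : Type u} [AddCommGroup M] [Module R M]
    [Module.Finite R M] (k : ℕ) :
    HasProjDimLE R M k ↔ Subsingleton (TorMod R (R ⧸ I) M (k + 1)) := by
  induction k generalizing M with
  | zero =>
    constructor
    · intro h
      have := Module.Projective.of_hasProjDimLE_zero h
      exact subsingleton_torMod_succ_of_projective _ 0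
    · intro h
      have := projective_of_subsingleton_torMod_one hintcl hprimary h
      exact Module.Projective.hasProjDimLE 0
  | succ k ih =>
    obtain ⟨n, f, hf⟩ := Module.Finite.exists_fin' R M
    rw [hasProjDimLE_succ_iff hf, subsingleton_torMod_succ_succ_iff hf, ih]

end

open IsLocalRing in
/-- **Corollary.**  Let `(R, 𝔪)` be a local Noetherian ring, `I` an integrally closed
`𝔪`-primary ideal and `M` a finitely generated `R`-module.  Then for `t ≥ 1`, `M` has
projective dimension `< t` if and only if `Tor_t^R(R/I, M) = 0`. -/
theorem projDim_lt_iff_tor_subsingleton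
    {R : Type u} [CommRing R] [IsLocalRing R] [IsNoetherianRing R]
    (I : Ideal R) (hintcl : I.IsIntClosed) (hprimary : I.radical = maximalIdeal R)
    (M : Type u) [AddCommGroup M] [Module R M] [Module.Finite R M]
    (t : ℕ) (ht : 1 ≤ t) :
    ProjDimLT R M t ↔ Subsingleton (TorMod R (R ⧸ I) M t) := by
  obtain ⟨k, rfl⟩ := Nat.exists_eq_add_of_le' ht
  rw [projDimLT_succ_iff, hasProjDimLE_iff_subsingleton_torMod hintcl hprimary]
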